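/- arXiv:1709.09311 — 6 statements merged into one kernel-verified Lean document; each statement's English description precedes it below -/
import Mathlib

section
/- Let m be a positive integer, K an index type, and for each k ∈ K let Sₖ be a nonempty subset of Fin m → ℝ; let Pₖ denote the set of nondominated elements of Sₖ. Assume that for every k and every f ∈ Sₖ there exists p ∈ Pₖ with p i ≤ f i for all i (every attainable point of each subproblem is weakly dominated by a sub-Pareto point). Then the set of nondominated elements of ⋃ₖ Sₖ equals the set of nondominated elements of ⋃ₖ Pₖ; i.e., the overall Pareto front is obtained by collecting the sub Pareto fronts and extracting the nondominated points. -/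
/-- The set of nondominated (Pareto optimal) elements of `T`. -/
def pareto {m : ℕ} (T : Set (Fin m → ℝ)) : Set (Fin m → ℝ) :=
  {s | s ∈ T ∧ ∀ t ∈ T, ¬ ((∀ i, t i ≤ s i) ∧ t ≠ s)}

/-- If every attainable point of each subproblem is weakly
dominated by a sub-Pareto point, then the overall Pareto front is obtained by
collecting the sub Pareto fronts and extracting the nondominated points. -/
theorem pareto_iUnion_eq_pareto_iUnion_pareto
    (m : ℕ) (hm : 0 < m) (K : Type*) (S : K → Set (Fin m → ℝ))
    (hS : ∀ k, (S k).Nonempty)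
    (h : ∀ k, ∀ f ∈ S k, ∃ p ∈ pareto (S k), ∀ i, p i ≤ f i) :
    pareto (⋃ k, S k) = pareto (⋃ k, pareto (S k)) := by
  ext s
  constructor
  · rintro ⟨hs, hmin⟩
    obtain ⟨k, hk⟩ := Set.mem_iUnion.1 hs
    exact ⟨Set.mem_iUnion.2 ⟨k, hk, fun t ht => hmin t (Set.mem_iUnion.2 ⟨k, ht⟩)⟩,
      fun t ht => hmin t (Set.iUnion_mono (fun _ _ hx => hx.1) ht)⟩
  · rintro ⟨hs, hmin⟩
    refine ⟨Set.iUnion_mono (fun _ _ hx => hx.1) hs, ?_⟩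
    rintro t ht ⟨hts, hne⟩
    obtain ⟨j, hj⟩ := Set.mem_iUnion.1 ht
    obtain ⟨p, hp, hpt⟩ := h j t hj
    have hps : p = s := by
      by_contra hps
      exact hmin p (Set.mem_iUnion.2 ⟨j, hp⟩) ⟨fun i => (hpt i).trans (hts i), hps⟩
    subst hps
    exact hne (funext fun i => le_antisymm (hts i) (hpt i))
end

section
/- Let m and N be positive integers, Y a type, 𝒴ₖ ⊆ Y feasible sets and J : Y → Fin N → (Fin m → ℝ) objective maps. For each k let 𝒴ₖ* = {y ∈ 𝒴ₖ : no y' ∈ 𝒴ₖ has J y' k dominating J y k} be the subproblem Pareto set, and let 𝒳* = {(y,k) : y ∈ 𝒴ₖ and no (y',l) with y' ∈ 𝒴ₗ has J y' l dominating J y k} be the Pareto set of the mixed problem. Assume that for each k and each y ∈ 𝒴ₖ there exists y* ∈ 𝒴ₖ* with (J y* k) i ≤ (J y k) i for all i. Then the overall Pareto front {J y k : (y,k) ∈ 𝒳*} equals the set of nondominated elements of ⋃ₖ {J y k : y ∈ 𝒴ₖ*} (the union of the sub Pareto fronts 𝒥ₖ*). -/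
/-- Under the attainment hypothesis, the overall Pareto front
equals the set of nondominated elements of the union of sub Pareto fronts. -/
theorem overall_front_eq_pareto_of_union_sub_fronts
    (m N : ℕ) (hm : 0 < m) (hN : 0 < N) (Y : Type*)
    (𝒴 : Fin N → Set Y) (J : Y → Fin N → Fin m → ℝ)
    (Ystar : Fin N → Set Y)
    (hYstar : ∀ k, Ystar k = {y ∈ 𝒴 k | ∀ y' ∈ 𝒴 k,
      ¬ ((∀ i, J y' k i ≤ J y k i) ∧ J y' k ≠ J y k)})
    (Xstar : Set (Y × Fin N))
    (hXstar : Xstar = {p | p.1 ∈ 𝒴 p.2 ∧ ∀ (y' : Y) (l : Fin N), y' ∈ 𝒴 l →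
      ¬ ((∀ i, J y' l i ≤ J p.1 p.2 i) ∧ J y' l ≠ J p.1 p.2)})
    (hatt : ∀ k, ∀ y ∈ 𝒴 k, ∃ ystar ∈ Ystar k, ∀ i, J ystar k i ≤ J y k i) :
    {v | ∃ p ∈ Xstar, J p.1 p.2 = v}
      = pareto (⋃ k, {v | ∃ y ∈ Ystar k, J y k = v}) := by
  have hsub : ∀ k, ∀ y ∈ Ystar k, y ∈ 𝒴 k := by
    intro k y hy
    rw [hYstar] at hy
    exact hy.1
  ext v
  constructor
  · rintro ⟨⟨y, k⟩, hp, rfl⟩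
    rw [hXstar] at hp
    obtain ⟨hy, hnd⟩ := hp
    refine ⟨Set.mem_iUnion.2 ⟨k, y, ?_, rfl⟩, ?_⟩
    · rw [hYstar]
      exact ⟨hy, fun y' hy' => hnd y' k hy'⟩
    · intro t ht
      obtain ⟨l, y', hy', rfl⟩ := Set.mem_iUnion.1 ht
      exact hnd y' l (hsub l y' hy')
  · rintro ⟨hv, hnd⟩
    obtain ⟨k, y, hy, rfl⟩ := Set.mem_iUnion.1 hv
    refine ⟨(y, k), ?_, rfl⟩
    rw [hXstar]
    refine ⟨hsub k y hy, ?_⟩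
    rintro y' l hy' ⟨hle, hne⟩
    obtain ⟨z, hz, hzle⟩ := hatt l y' hy'
    refine hnd (J z l) (Set.mem_iUnion.2 ⟨l, z, hz, rfl⟩)
      ⟨fun i => (hzle i).trans (hle i), fun heq => hne ?_⟩
    exact funext fun i => le_antisymm (hle i) (congrFun heq i ▸ hzle i)
end

section
/- Let m be a positive integer and K an index type with sets Sₖ ⊆ (Fin m → ℝ), each nonempty. Fix k and suppose that for each coordinate i there exists an anchor point aᵢ ∈ Sₖ with aᵢ i ≤ f i for all f ∈ Sₖ; define the utopia point u of Sₖ by u i = aᵢ i. If there exists p ∈ ⋃ₗ Sₗ with p i < u i for every i (the utopia point of subproblem k is strictly dominated in every coordinate by an attainable point), then no element of Sₖ is nondominated in ⋃ₗ Sₗ; i.e., subproblem k contributes no point to the overall Pareto front and can be pruned. -/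
/-- If the utopia point of subproblem k is strictly dominated in
every coordinate by an attainable point, then subproblem k contributes no
point to the overall Pareto front. -/
theorem utopia_pruning
    (m : ℕ) (hm : 0 < m) (K : Type*) (S : K → Set (Fin m → ℝ))
    (hS : ∀ l, (S l).Nonempty) (k : K)
    (a : Fin m → (Fin m → ℝ)) (ha : ∀ i, a i ∈ S k)
    (hanchor : ∀ i, ∀ f ∈ S k, a i i ≤ f i)
    (u : Fin m → ℝ) (hu : ∀ i, u i = a i i)
    (p : Fin m → ℝ) (hp : p ∈ ⋃ l, S l) (hpu : ∀ i, p i < u i) :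
    ∀ s ∈ S k, s ∉ pareto (⋃ l, S l) := by
  intro s hs hpar
  have hlt : ∀ i, p i < s i := fun i =>
    (hpu i).trans_le ((hu i).trans_le (hanchor i s hs))
  exact hpar.2 p hp ⟨fun i => (hlt i).le, fun h => (hlt ⟨0, hm⟩).ne (congrFun h _)⟩
end

section
/- Let m be a positive integer and K an index type with sets Sₖ ⊆ (Fin m → ℝ). Fix k ∈ K, suppose Sₖ is nonempty, and suppose there exists p ∈ ⋃_{l ≠ k} Sₗ such that p i ≤ f i for every f ∈ Sₖ and every coordinate i (p weakly dominates the entire attainable set of subproblem k, in particular p is componentwise ≤ the utopia point of Sₖ). Then the set of nondominated elements of ⋃_{l ≠ k} Sₗ equals the set of nondominated elements of ⋃_{l ∈ K} Sₗ; i.e., removing subproblem k does not change the overall Pareto front as a set of objective vectors. -/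
/-- Enlarging a set by points that it already weakly dominates does not change its Pareto front. -/
theorem pareto_eq_of_subset_of_forall_exists_le {m : ℕ} {A U : Set (Fin m → ℝ)} (hAU : A ⊆ U)
    (h : ∀ u ∈ U, ∃ a ∈ A, a ≤ u) : pareto A = pareto U := by
  ext s
  constructor
  · rintro ⟨hs, hmin⟩
    refine ⟨hAU hs, fun t ht ⟨hts, hne⟩ => ?_⟩
    obtain ⟨a, ha, hat⟩ := h t ht
    have has : a = s := by
      by_contra hne'
      exact hmin a ha ⟨le_trans hat hts, hne'⟩
    subst has
    exact hne (le_antisymm hts hat)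
  · rintro ⟨hs, hmin⟩
    refine ⟨?_, fun t ht => hmin t (hAU ht)⟩
    obtain ⟨a, ha, has⟩ := h s hs
    have hEq : a = s := by
      by_contra hne
      exact hmin a (hAU ha) ⟨has, hne⟩
    exact hEq ▸ ha

/-- If a point attainable by some other subproblem weakly
dominates the entire attainable set of subproblem k, then removing subproblem
k does not change the overall Pareto front. -/
theorem prune_one_subproblem
    (m : ℕ) (hm : 0 < m) (K : Type*) (S : K → Set (Fin m → ℝ))
    (k : K) (hk : (S k).Nonempty)
    (p : Fin m → ℝ) (hp : p ∈ ⋃ l ∈ ({k}ᶜ : Set K), S l)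
    (hdom : ∀ f ∈ S k, ∀ i, p i ≤ f i) :
    pareto (⋃ l ∈ ({k}ᶜ : Set K), S l) = pareto (⋃ l, S l) := by
  refine pareto_eq_of_subset_of_forall_exists_le
    (Set.iUnion₂_subset fun l _ => Set.subset_iUnion S l) fun u hu => ?_
  obtain ⟨l, hl⟩ := Set.mem_iUnion.mp hu
  by_cases hlk : l = k
  · subst hlk
    exact ⟨p, hp, hdom u hl⟩
  · exact ⟨u, Set.mem_biUnion (Set.mem_compl_singleton_iff.mpr hlk) hl, le_rfl⟩
end

section
/- Let m be a positive integer, K a finite index set with sets Sₖ ⊆ (Fin m → ℝ), and let K_∅ ⊆ K be a set of pruned indices. Assume that for every k ∈ K_∅ there exists p ∈ ⋃_{l ∈ K \ K_∅} Sₗ (a point attainable by some unpruned subproblem) such that p i ≤ f i for every f ∈ Sₖ and every coordinate i. Then the set of nondominated elements of ⋃_{l ∈ K \ K_∅} Sₗ equals the set of nondominated elements of ⋃_{l ∈ K} Sₗ; i.e., simultaneously pruning all subproblems in K_∅ leaves the overall Pareto front unchanged. -/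
/-- Passing to a subset that contains a lower bound of every element preserves the Pareto front. -/
theorem pareto_eq_of_subset_of_forall_exists_le_s5 {m : ℕ} {U T : Set (Fin m → ℝ)} (hUT : U ⊆ T)
    (hle : ∀ t ∈ T, ∃ p ∈ U, p ≤ t) : pareto U = pareto T := by
  ext s
  constructor
  · rintro ⟨hsU, hs⟩
    refine ⟨hUT hsU, fun t ht ⟨hts, hne⟩ => ?_⟩
    obtain ⟨p, hpU, hpt⟩ := hle t ht
    have hps : p = s := by
      by_contra hps
      exact hs p hpU ⟨hpt.trans hts, hps⟩
    exact hne (le_antisymm hts (hps ▸ hpt))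
  · rintro ⟨hsT, hs⟩
    obtain ⟨p, hpU, hps⟩ := hle s hsT
    have hp : p = s := by
      by_contra hp
      exact hs p (hUT hpU) ⟨hps, hp⟩
    exact ⟨hp ▸ hpU, fun t ht => hs t (hUT ht)⟩

/-- Simultaneously pruning all subproblems in `Kdel`, each of
whose attainable set is weakly dominated by a point attainable by some
unpruned subproblem, leaves the overall Pareto front unchanged. -/
theorem prune_many_subproblems
    (m : ℕ) (hm : 0 < m) (K : Type*) [Fintype K]
    (S : K → Set (Fin m → ℝ)) (Kdel : Set K)
    (h : ∀ k ∈ Kdel, ∃ p ∈ ⋃ l ∈ Kdelᶜ, S l, ∀ f ∈ S k, ∀ i, p i ≤ f i) :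
    pareto (⋃ l ∈ Kdelᶜ, S l) = pareto (⋃ l, S l) := by
  refine pareto_eq_of_subset_of_forall_exists_le_s5
    (Set.iUnion₂_subset fun l _ => Set.subset_iUnion S l) fun t ht => ?_
  obtain ⟨k, hk⟩ := Set.mem_iUnion.mp ht
  by_cases hkd : k ∈ Kdel
  · obtain ⟨p, hp, hpf⟩ := h k hkd
    exact ⟨p, hp, hpf t hk⟩
  · exact ⟨t, Set.mem_biUnion hkd hk, le_rfl⟩
end

section
/- Center-point pruning can over-prune: there exist finite nonempty sets A, B ⊆ (Fin 2 → ℝ) (objective vectors of a master front and of a subproblem, respectively) and points a¹, a², c ∈ B such that (i) a¹ minimizes the first coordinate over B and a² minimizes the second coordinate over B, with a¹ 1 ≠ a² 1 and a² 0 ≠ a¹ 0; (ii) c minimizes the first coordinate over the constrained set D = { f ∈ B : (f 1 − a² 1)/(a¹ 1 − a² 1) − (f 0 − a¹ 0)/(a² 0 − a¹ 0) ≤ 0 } and c ∈ D (c is the center point of B); (iii) some point of A dominates c (so the center-point test prunes the subproblem); and yet (iv) some point of B is nondominated in A ∪ B (the subproblem actually contributes to the true Pareto front). -/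
/-- Center-point pruning can over-prune: there is a master front
`A` and a subproblem front `B` with anchor points `a1`, `a2` and center point
`c` such that `c` is dominated by a point of `A` (so the subproblem is
pruned), yet some point of `B` is nondominated in `A ∪ B`. -/
theorem center_point_pruning_can_over_prune :
    ∃ (A B : Set (Fin 2 → ℝ)), A.Finite ∧ B.Finite ∧ A.Nonempty ∧ B.Nonempty ∧
      ∃ a1 a2 c : Fin 2 → ℝ, a1 ∈ B ∧ a2 ∈ B ∧
        (∀ f ∈ B, a1 0 ≤ f 0) ∧ (∀ f ∈ B, a2 1 ≤ f 1) ∧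
        a1 1 ≠ a2 1 ∧ a2 0 ≠ a1 0 ∧
        c ∈ {f ∈ B | (f 1 - a2 1) / (a1 1 - a2 1)
              - (f 0 - a1 0) / (a2 0 - a1 0) ≤ 0} ∧
        (∀ f ∈ {f ∈ B | (f 1 - a2 1) / (a1 1 - a2 1)
              - (f 0 - a1 0) / (a2 0 - a1 0) ≤ 0}, c 0 ≤ f 0) ∧
        (∃ q ∈ A, (∀ i, q i ≤ c i) ∧ q ≠ c) ∧
        (∃ b ∈ B, b ∈ pareto (A ∪ B)) := by
  refine ⟨{![1, 1 / 2]}, {![0, 2], ![2, 0], ![1, 1]}, Set.toFinite _, Set.toFinite _,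
    by simp, by simp, ![0, 2], ![2, 0], ![1, 1], by simp, by simp, ?_, ?_, by simp, by simp,
    ?_, ?_, ⟨![1, 1 / 2], rfl, ?_, ?_⟩, ![0, 2], by simp, by simp, ?_⟩
  · rintro f (rfl | rfl | rfl) <;> norm_num
  · rintro f (rfl | rfl | rfl) <;> norm_num
  · exact ⟨by simp, by norm_num⟩
  · rintro f ⟨rfl | rfl | rfl, hf⟩
    · norm_num at hf
    · norm_num
    · norm_num
  · intro i
    fin_cases i <;> norm_num
  · intro h
    have := congrFun h 1
    norm_num at this
  · rintro t (rfl | rfl | rfl | rfl) ⟨hle, hne⟩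
    · have := hle 0
      norm_num at this
    · exact hne rfl
    · have := hle 0
      norm_num at this
    · have := hle 0
      norm_num at this
end
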